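/- c(n,n) = 2 for all n ≥ 1, c(n,n−1) = 2 for all n ≥ 2, and for all n ≥ 4 and k ≥ ⌊√n⌋ the following hold: c(n,k,π) = 2^{n−(k+1)π}·(2^π − 1)·q(π, k−1) whenever 1 ≤ π ≤ ⌊n/(k+1)⌋, and c(n,k,π) = 2^{n−kπ}·q(π, k−1) whenever ⌈(n+1)/(k+1)⌉ ≤ π ≤ ⌊n/k⌋; consequently c(n,k) = Σ_{π=1}^{⌊n/k⌋} c(n,k,π). -/

import Mathlib

/-- `listPow Y k` is the sequence `Y` repeated `k` times (i.e. `Y^k`). -/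
def listPow {α : Type*} (Y : List α) : ℕ → List α
  | 0 => []
  | k + 1 => Y ++ listPow Y k

/-- The curling number of a finite sequence `S`: the largest `k` such that
`S = X ++ Y^k` for some (possibly empty) `X` and nonempty `Y`. -/
noncomputable def CN {α : Type*} (S : List α) : ℕ :=
  sSup {k | ∃ X Y : List α, Y ≠ [] ∧ S = X ++ listPow Y k}

/-- A nonempty sequence is primitive if it is not a power `T^i` with `i ≥ 2`. -/
def Primitive {α : Type*} (S : List α) : Prop :=
  S ≠ [] ∧ ∀ (T : List α) (i : ℕ), 2 ≤ i → S ≠ listPow T i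

/-- `T` is a proper suffix of `S`: a suffix which is strictly shorter than `S`. -/
def ProperSuffix {α : Type*} (T S : List α) : Prop := T <:+ S ∧ T.length < S.length

/-- A sequence `S` with curling number `k` is robust if no proper suffix of
`S^(k+1)` has curling number `≥ k + 1`. -/
def Robust {α : Type*} (S : List α) : Prop :=
  ∀ T : List α, ProperSuffix T (listPow S (CN S + 1)) → CN T ≤ CN S

/-- `c(n,k)`: the number of binary sequences of length `n` with curling number `k`. -/
noncomputable def cCount (n k : ℕ) : ℕ :=
  {S : List Bool | S.length = n ∧ CN S = k}.ncard

/-- `p(n,k)`: the number of primitive binary sequences of length `n` with curling number `k`. -/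
noncomputable def pCount (n k : ℕ) : ℕ :=
  {S : List Bool | S.length = n ∧ CN S = k ∧ Primitive S}.ncard

/-- `p'(n,k)`: the number of primitive robust binary sequences of length `n`
with curling number `k`. -/
noncomputable def pCount' (n k : ℕ) : ℕ :=
  {S : List Bool | S.length = n ∧ CN S = k ∧ Primitive S ∧ Robust S}.ncard

/-- `q(n,k) = Σ_{i=1}^{k} p(n,i)`. -/
noncomputable def qCount (n k : ℕ) : ℕ := ∑ i ∈ Finset.Icc 1 k, pCount n i

/-- `S^{[i]}`: the suffix of `S` of length `i`. -/
def suffLen {α : Type*} (S : List α) (i : ℕ) : List α := S.drop (S.length - i)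

/-- `A(n,i)`: binary sequences `S` of length `n` with `CN S = 1` and `CN (S^{[i]} S) = 1`. -/
def setA (n i : ℕ) : Set (List Bool) :=
  {S | S.length = n ∧ CN S = 1 ∧ CN (suffLen S i ++ S) = 1}

/-- `B(n,i)`: binary sequences `S` of length `n` with `CN S = 1` and `CN (S S^{[i]} S) = 1`. -/
def setB (n i : ℕ) : Set (List Bool) :=
  {S | S.length = n ∧ CN S = 1 ∧ CN (S ++ suffLen S i ++ S) = 1}

/-- `E(n,i,j)`: binary sequences `S` of length `n` with `CN S = 1`
and `S^{[i]} S ∈ B(n+i, j)`. -/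
def setE (n i j : ℕ) : Set (List Bool) :=
  {S | S.length = n ∧ CN S = 1 ∧ (suffLen S i ++ S) ∈ setB (n + i) j}

noncomputable def aCount (n i : ℕ) : ℕ := (setA n i).ncard
noncomputable def bCount (n i : ℕ) : ℕ := (setB n i).ncard
noncomputable def eCount (n i j : ℕ) : ℕ := (setE n i j).ncard

/-- `π(S)`: the length of the (unique) shortest nonempty `Y` with `S = X ++ Y^(CN S)`. -/
noncomputable def piLen (S : List Bool) : ℕ :=
  sInf {m | ∃ X Y : List Bool, Y ≠ [] ∧ Y.length = m ∧ S = X ++ listPow Y (CN S)}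

/-- `c(n,k,π)`: the number of binary sequences of length `n` with curling number `k`
and shortest repeated block of length `π`. -/
noncomputable def cCount3 (n k π : ℕ) : ℕ :=
  {S : List Bool | S.length = n ∧ CN S = k ∧ piLen S = π}.ncard

section Powers

variable {α : Type*}

theorem listPow_eq_flatten (Y : List α) (k : ℕ) :
    listPow Y k = (List.replicate k Y).flatten := by
  induction k with
  | zero => rfl
  | succ k ih => simp [listPow, ih, List.replicate_succ]

theorem length_listPow (Y : List α) (k : ℕ) : (listPow Y k).length = k * Y.length := by
  simp [listPow_eq_flatten]

theorem reverse_listPow (Y : List α) (k : ℕ) :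
    (listPow Y k).reverse = listPow Y.reverse k := by
  simp [listPow_eq_flatten, List.reverse_flatten]

theorem listPow_add (Y : List α) (a b : ℕ) :
    listPow Y (a + b) = listPow Y a ++ listPow Y b := by
  rw [listPow_eq_flatten, List.replicate_add, List.flatten_append, ← listPow_eq_flatten,
    ← listPow_eq_flatten]

theorem listPow_listPow (Y : List α) (a b : ℕ) :
    listPow (listPow Y a) b = listPow Y (b * a) := by
  induction b with
  | zero => simp [listPow]
  | succ b ih => rw [listPow, ih, ← listPow_add]; congr 1; ring

theorem listPow_one (Y : List α) : listPow Y 1 = Y := by simp [listPow]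

theorem getElem?_listPow (Y : List α) (k i : ℕ) (hi : i < k * Y.length) :
    (listPow Y k)[i]? = Y[i % Y.length]? := by
  induction k generalizing i with
  | zero => simp at hi
  | succ k ih =>
    rw [listPow]
    by_cases h : i < Y.length
    · rw [List.getElem?_append_left h, Nat.mod_eq_of_lt h]
    · push Not at h
      rw [List.getElem?_append_right h, ih _ (by rw [add_mul] at hi; omega),
        Nat.mod_eq_sub_mod h]

/-- `S` ends with a `k`-th power of a block of length `w`, expressed through the letters of the
reversed list. -/
def EndsWithPow (S : List α) (w k : ℕ) : Prop :=
  1 ≤ w ∧ k * w ≤ S.length ∧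
    ∀ i, i + w < k * w → S.reverse[i]? = S.reverse[i + w]?

theorem EndsWithPow.getElem?_mod {S : List α} {w k : ℕ} (h : EndsWithPow S w k) (i : ℕ)
    (hi : i < k * w) : S.reverse[i]? = S.reverse[i % w]? := by
  induction i using Nat.strong_induction_on with
  | _ i ih =>
    by_cases hw : i < w
    · rw [Nat.mod_eq_of_lt hw]
    · push Not at hw
      have h1 := h.1
      rw [Nat.mod_eq_sub_mod hw, ← ih (i - w) (by omega) (by omega),
        h.2.2 (i - w) (by omega), Nat.sub_add_cancel hw]

theorem endsWithPow_append_listPow (X Y : List α) (k : ℕ) (hY : Y ≠ []) :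
    EndsWithPow (X ++ listPow Y k) Y.length k := by
  refine ⟨List.length_pos_iff.mpr hY, by simp [length_listPow], fun i hi => ?_⟩
  rw [List.reverse_append, reverse_listPow,
    List.getElem?_append_left (by simp [length_listPow]; omega),
    List.getElem?_append_left (by simp [length_listPow]; omega),
    getElem?_listPow _ _ _ (by simp; omega), getElem?_listPow _ _ _ (by simpa using hi)]
  simp

theorem EndsWithPow.exists_eq {S : List α} {w k : ℕ} (h : EndsWithPow S w k) (hk : 1 ≤ k) :
    S = S.take (S.length - k * w) ++ listPow (S.drop (S.length - w)) k := by
  have hw : w ≤ S.length := le_trans (Nat.le_mul_of_pos_left w hk) h.2.1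
  have key : S.reverse.take (k * w) = listPow (S.reverse.take w) k := by
    apply List.ext_getElem?
    intro i
    have hl : (S.reverse.take w).length = w := by simpa using hw
    by_cases hi : i < k * w
    · rw [getElem?_listPow _ _ _ (by rwa [hl]), hl, List.getElem?_take_of_lt hi,
        List.getElem?_take_of_lt (Nat.mod_lt _ h.1), h.getElem?_mod i hi]
    · rw [List.getElem?_eq_none, List.getElem?_eq_none]
      · rw [length_listPow, hl]; omega
      · simp; omega
  apply List.reverse_injective
  rw [List.reverse_append, reverse_listPow, List.reverse_drop, List.reverse_take,
    Nat.sub_sub_self hw, Nat.sub_sub_self h.2.1, ← key, List.take_append_drop]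

theorem endsWithPow_iff {S : List α} {w k : ℕ} (hk : 1 ≤ k) :
    EndsWithPow S w k ↔ ∃ X Y : List α, Y ≠ [] ∧ Y.length = w ∧ S = X ++ listPow Y k := by
  constructor
  · intro h
    have hw : w ≤ S.length := le_trans (Nat.le_mul_of_pos_left w hk) h.2.1
    have hl : (S.drop (S.length - w)).length = w := by simp; omega
    refine ⟨_, _, ?_, hl, h.exists_eq hk⟩
    rw [← List.length_pos_iff, hl]
    exact h.1
  · rintro ⟨X, Y, hY, rfl, rfl⟩
    exact endsWithPow_append_listPow X Y k hY

theorem EndsWithPow.mono {S : List α} {w k j : ℕ} (h : EndsWithPow S w k) (hj : j ≤ k) :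
    EndsWithPow S w j :=
  have : j * w ≤ k * w := Nat.mul_le_mul_right w hj
  ⟨h.1, this.trans h.2.1, fun i hi => h.2.2 i (by omega)⟩

theorem EndsWithPow.append_left {Y : List α} {w k : ℕ} (h : EndsWithPow Y w k) (X : List α) :
    EndsWithPow (X ++ Y) w k := by
  have := h.2.1
  refine ⟨h.1, by simp; omega, fun i hi => ?_⟩
  rw [List.reverse_append, List.getElem?_append_left (by simp; omega),
    List.getElem?_append_left (by simp; omega), h.2.2 i hi]

theorem EndsWithPow.of_append_left {X Y : List α} {w k : ℕ} (h : EndsWithPow (X ++ Y) w k)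
    (hl : k * w ≤ Y.length) : EndsWithPow Y w k := by
  refine ⟨h.1, hl, fun i hi => ?_⟩
  have := h.2.2 i hi
  rwa [List.reverse_append, List.getElem?_append_left (by simp; omega),
    List.getElem?_append_left (by simp; omega)] at this

/-- The Fine–Wilf theorem for the powers at the end of a list. -/
theorem EndsWithPow.gcd {S : List α} {w k p j L : ℕ} (h : EndsWithPow S w k)
    (h' : EndsWithPow S p j) (hk : L ≤ k * w) (hj : L ≤ j * p)
    (hL : w + p - w.gcd p ≤ L) (i : ℕ) (hi : i + w.gcd p < L) :
    S.reverse[i]? = S.reverse[i + w.gcd p]? := by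
  have hlen : (S.reverse.take L).length = L := by
    have := h.2.1
    simp; omega
  have period : ∀ {m : ℕ}, (∀ i, i + m < L → S.reverse[i]? = S.reverse[i + m]?) →
      List.HasPeriod (S.reverse.take L) m := by
    intro m hm
    rw [List.hasPeriod_iff_getElem?, hlen]
    intro i hi
    rw [List.getElem?_take_of_lt (by omega), List.getElem?_take_of_lt (by omega)]
    exact hm i (by omega)
  have := List.HasPeriod.gcd (period fun i hi => h.2.2 i (by omega))
    (period fun i hi => h'.2.2 i (by omega)) (by rwa [hlen])
  rw [List.hasPeriod_iff_getElem?, hlen] at this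
  have := this i (by omega)
  rwa [List.getElem?_take_of_lt (by omega), List.getElem?_take_of_lt (by omega)] at this

theorem endsWithPow_length_one {S : List α} (hS : S ≠ []) : EndsWithPow S S.length 1 :=
  ⟨List.length_pos_iff.mpr hS, by simp, fun i hi => by omega⟩

theorem not_primitive_of_endsWithPow {Y : List α} {g i : ℕ} (hi : 2 ≤ i)
    (h : EndsWithPow Y g i) (hl : i * g = Y.length) : ¬ Primitive Y := by
  intro hp
  have := h.exists_eq (by omega)
  rw [hl, Nat.sub_self, List.take_zero, List.nil_append] at this
  exact hp.2 _ i hi this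

theorem EndsWithPow.le_length {S : List α} {w k : ℕ} (h : EndsWithPow S w k) : k ≤ S.length :=
  (Nat.le_mul_of_pos_right k h.1).trans h.2.1

theorem bddAbove_curling (S : List α) :
    BddAbove {k | ∃ X Y : List α, Y ≠ [] ∧ S = X ++ listPow Y k} := by
  refine ⟨S.length, ?_⟩
  rintro k ⟨X, Y, hY, rfl⟩
  exact (endsWithPow_append_listPow X Y k hY).le_length

theorem le_CN_iff {S : List α} {k : ℕ} (hk : 1 ≤ k) :
    k ≤ CN S ↔ ∃ w, EndsWithPow S w k := by
  constructor
  · intro h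
    have hne : {k | ∃ X Y : List α, Y ≠ [] ∧ S = X ++ listPow Y k}.Nonempty := by
      by_contra hne
      rw [Set.not_nonempty_iff_eq_empty] at hne
      rw [CN, hne] at h
      simp at h
      omega
    obtain ⟨X, Y, hY, hS⟩ := Nat.sSup_mem hne (bddAbove_curling S)
    refine ⟨Y.length, EndsWithPow.mono ?_ h⟩
    rw [hS]
    convert endsWithPow_append_listPow X Y _ hY
    rw [← hS]; rfl
  · rintro ⟨w, h⟩
    obtain ⟨X, Y, hY, -, hS⟩ := (endsWithPow_iff hk).1 h
    exact le_csSup (bddAbove_curling S) ⟨X, Y, hY, hS⟩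

theorem one_le_CN {S : List α} (hS : S ≠ []) : 1 ≤ CN S :=
  (le_CN_iff le_rfl).2 ⟨_, endsWithPow_length_one hS⟩

theorem CN_le_length (S : List α) : CN S ≤ S.length := by
  by_cases h : CN S = 0
  · omega
  · obtain ⟨w, hw⟩ := (le_CN_iff (S := S) (k := CN S) (by omega)).1 le_rfl
    exact hw.le_length

end Powers

section Characterization

variable {S X Y : List Bool} {k w : ℕ}

theorem piLen_eq_sInf (hk : 1 ≤ CN S) : piLen S = sInf {w | EndsWithPow S w (CN S)} := by
  rw [piLen]
  congr 1
  ext w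
  exact (endsWithPow_iff hk).symm

theorem endsWithPow_piLen (hk : 1 ≤ CN S) : EndsWithPow S (piLen S) (CN S) := by
  rw [piLen_eq_sInf hk]
  exact Nat.sInf_mem ((le_CN_iff hk).1 le_rfl)

theorem piLen_le (hk : 1 ≤ CN S) (h : EndsWithPow S w (CN S)) : piLen S ≤ w := by
  rw [piLen_eq_sInf hk]
  exact Nat.sInf_le h

theorem EndsWithPow.append_listPow {j : ℕ} (h : EndsWithPow Y w j) (hk : 1 ≤ k) :
    EndsWithPow (X ++ listPow Y k) w j := by
  obtain ⟨k, rfl⟩ := Nat.exists_eq_add_of_le' hk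
  rw [listPow_add, listPow_one, ← List.append_assoc]
  exact h.append_left _

theorem EndsWithPow.of_append_listPow {j : ℕ} (h : EndsWithPow (X ++ listPow Y k) w j)
    (hk : 1 ≤ k) (hl : j * w ≤ Y.length) : EndsWithPow Y w j := by
  obtain ⟨k, rfl⟩ := Nat.exists_eq_add_of_le' hk
  rw [listPow_add, listPow_one, ← List.append_assoc] at h
  exact h.of_append_left hl

theorem endsWithPow_succ_iff (hk : 1 ≤ k) (hY : Y ≠ []) :
    EndsWithPow (X ++ listPow Y k) Y.length (k + 1) ↔ Y <:+ X := by
  constructor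
  · intro h
    obtain ⟨X', Y', -, hl, h⟩ := (endsWithPow_iff (by omega)).1 h
    rw [add_comm k 1, listPow_add, listPow_one, ← List.append_assoc] at h
    have hlen : (listPow Y k).length = (listPow Y' k).length := by
      rw [length_listPow, length_listPow, hl]
    obtain ⟨h1, h2⟩ := List.append_inj' h hlen
    obtain ⟨k, rfl⟩ := Nat.exists_eq_add_of_le' hk
    rw [listPow_add, listPow_add, listPow_one, listPow_one] at h2
    rw [h1, (List.append_inj' h2 hl.symm).2]
    exact List.suffix_append _ _
  · rintro ⟨Z, rfl⟩
    have := endsWithPow_append_listPow Z Y (k + 1) hY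
    rwa [add_comm k 1, listPow_add, listPow_one, ← List.append_assoc, add_comm 1 k] at this

theorem two_le_div_of_dvd_lt {g m : ℕ} (h : g ∣ m) (hlt : g < m) :
    2 ≤ m / g ∧ m / g * g = m := by
  refine ⟨?_, Nat.div_mul_cancel h⟩
  obtain ⟨c, rfl⟩ := h
  rcases Nat.eq_zero_or_pos g with rfl | hg
  · simp at hlt
  rw [Nat.mul_div_cancel_left _ hg]
  by_contra hc
  interval_cases c <;> simp at hlt

theorem not_endsWithPow_of_lt (hk : 2 ≤ k) (hn : (X ++ listPow Y k).length < (k + 1) ^ 2)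
    (hp : Primitive Y) (hC : CN Y < k) (hw : w < Y.length) :
    ¬ EndsWithPow (X ++ listPow Y k) w k := by
  intro h
  have hY := endsWithPow_append_listPow X Y k hp.1
  have hw1 := h.1
  have hlen := hY.2.1
  set S := X ++ listPow Y k with hS
  have h1 : Y.length < k * w := by
    by_contra hle
    have := (le_CN_iff (by omega)).2 ⟨w, h.of_append_listPow (by omega) (not_lt.1 hle)⟩
    omega
  have h2 : w + Y.length ≤ k * w + 1 := by
    by_contra hlt
    obtain ⟨m, rfl⟩ := Nat.exists_eq_add_of_le' hk
    have hw3 : 3 ≤ w := by omega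
    nlinarith [Nat.mul_le_mul_left (m + 2) (show (m + 2) * w + 2 ≤ w + Y.length by omega),
      Nat.mul_le_mul_left ((m + 2) * (m + 1)) hw3]
  have hdvd : w.gcd Y.length ∣ Y.length := Nat.gcd_dvd_right _ _
  have hg : 0 < w.gcd Y.length := Nat.gcd_pos_of_pos_left _ hw1
  have hgw : w.gcd Y.length ≤ w := Nat.gcd_le_left _ hw1
  obtain ⟨hi, hm⟩ := two_le_div_of_dvd_lt hdvd (by omega)
  have hper := h.gcd hY le_rfl (Nat.mul_le_mul_left k hw.le) (by omega)
  have hE : EndsWithPow S (w.gcd Y.length) (Y.length / w.gcd Y.length) := by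
    refine ⟨hg, ?_, fun i hi => hper i (by omega)⟩
    rw [hm]
    exact le_trans (Nat.le_mul_of_pos_left _ (by omega)) hlen
  exact not_primitive_of_endsWithPow hi (hE.of_append_listPow (by omega) hm.le) hm hp

theorem EndsWithPow.eq_head {S : List Bool} (h : EndsWithPow S 1 k) (i : ℕ) (hi : i < k) :
    S.reverse[i]? = S.reverse[0]? := by
  rw [h.getElem?_mod i (by omega), Nat.mod_one]

theorem not_endsWithPow_succ_of_gt (hk : 2 ≤ k)
    (hn : (X ++ listPow Y k).length < (k + 1) ^ 2) (hY : Y ≠ []) (hX : ¬ Y <:+ X)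
    (hw : Y.length < w) : ¬ EndsWithPow (X ++ listPow Y k) w (k + 1) := by
  intro h
  rw [← endsWithPow_succ_iff (k := k) (by omega) hY] at hX
  have hE := endsWithPow_append_listPow X Y k hY
  have hlen := h.2.1
  have hwk : w ≤ k := by
    by_contra hlt
    nlinarith [Nat.mul_le_mul_left (k + 1) (show k + 1 ≤ w by omega)]
  have hp := hE.1
  set S := X ++ listPow Y k with hS
  set p := Y.length with hp_def
  apply hX
  have hmul : (k + 1) * p ≤ (k + 1) * w := Nat.mul_le_mul_left _ hw.le
  refine ⟨hp, hmul.trans hlen, fun i hi => ?_⟩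
  have e1 : (k + 1) * p = k * p + p := by ring
  have e2 : (k + 1) * w = k * w + w := by ring
  by_cases hik : i + p < k * p
  · exact hE.2.2 i hik
  by_cases hwp : w + p ≤ k * p
  · have h1 := h.2.2 (i - w) (by omega)
    have h2 := h.2.2 (i - w + p) (by omega)
    have h3 := hE.2.2 (i - w) (by omega)
    rw [Nat.sub_add_cancel (by omega)] at h1
    rw [show i - w + p + w = i + p by omega] at h2
    rw [← h1, h3, h2]
  · have hp1 : p = 1 := by
      by_contra hne
      nlinarith [Nat.mul_le_mul_left k (show 2 ≤ p by omega)]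
    rw [hp1] at hE hwp hik hi ⊢
    have hw : w = k := by omega
    have hi : i = k - 1 := by omega
    subst hw
    rw [hi, Nat.sub_add_cancel (by omega), hE.eq_head _ (by omega)]
    simpa using h.2.2 0 (by nlinarith)

theorem CN_piLen_append_listPow (hk : 2 ≤ k) (hn : (X ++ listPow Y k).length < (k + 1) ^ 2)
    (hp : Primitive Y) (hC : CN Y < k) (hX : ¬ Y <:+ X) :
    CN (X ++ listPow Y k) = k ∧ piLen (X ++ listPow Y k) = Y.length := by
  have hE := endsWithPow_append_listPow X Y k hp.1
  have hlt : ∀ w, w < Y.length → ¬ EndsWithPow (X ++ listPow Y k) w k := fun w hw =>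
    not_endsWithPow_of_lt hk hn hp hC hw
  have hCN : CN (X ++ listPow Y k) = k := by
    apply le_antisymm
    · by_contra hgt
      obtain ⟨w, hw⟩ := (le_CN_iff (k := k + 1) (by omega)).1 (not_le.1 hgt)
      rcases lt_trichotomy w Y.length with h | h | h
      · exact hlt w h (hw.mono (by omega))
      · rw [h, endsWithPow_succ_iff (by omega) hp.1] at hw
        exact hX hw
      · exact not_endsWithPow_succ_of_gt hk hn hp.1 hX h hw
    · exact (le_CN_iff (by omega)).2 ⟨_, hE⟩
  refine ⟨hCN, le_antisymm (piLen_le (by omega) (by rwa [hCN])) ?_⟩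
  by_contra hgt
  have := endsWithPow_piLen (S := X ++ listPow Y k) (by omega)
  rw [hCN] at this
  exact hlt _ (not_le.1 hgt) this

theorem exists_eq_append_listPow (hk : 2 ≤ CN S) :
    ∃ X Y : List Bool, S = X ++ listPow Y (CN S) ∧ Y.length = piLen S ∧ Primitive Y ∧
      CN Y < CN S ∧ ¬ Y <:+ X := by
  obtain ⟨X, Y, hY, hl, hS⟩ :=
    (endsWithPow_iff (by omega)).1 (endsWithPow_piLen (S := S) (by omega))
  generalize hc : CN S = k at *
  refine ⟨X, Y, hS, hl, ⟨hY, fun T i hi hT => ?_⟩, ?_, fun hX => ?_⟩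
  · have hT0 : T ≠ [] := by
      rintro rfl
      apply hY
      rw [hT, ← List.length_eq_zero_iff, length_listPow]
      simp
    have := endsWithPow_append_listPow X T (k * i) hT0
    rw [← listPow_listPow, ← hT, ← hS] at this
    have := (le_CN_iff (by nlinarith)).2 ⟨_, this⟩
    nlinarith
  · by_contra hC
    obtain ⟨w, hw⟩ := (le_CN_iff (by omega)).1 (not_lt.1 hC)
    have h1 := hw.append_listPow (X := X) (k := k) (by omega)
    rw [← hS] at h1
    have h2 := piLen_le (by omega) (show EndsWithPow S w (CN S) by rwa [hc])
    have h3 := hw.2.1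
    have h4 := hw.1
    nlinarith
  · rw [← endsWithPow_succ_iff (k := k) (by omega) hY, ← hS] at hX
    have := (le_CN_iff (by omega)).2 ⟨_, hX⟩
    omega

end Characterization

section Counting

theorem finite_length_eq (n : ℕ) : {S : List Bool | S.length = n}.Finite :=
  List.finite_length_eq Bool n

theorem ncard_length_eq (n : ℕ) : {S : List Bool | S.length = n}.ncard = 2 ^ n := by
  have : Nat.card (List.Vector Bool n) = 2 ^ n := by simp [card_vector]
  exact this

theorem ncard_eq_sum_fiber {α : Type*} {A : Set α} (hA : A.Finite) (f : α → ℕ) (I : Finset ℕ)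
    (hf : ∀ a ∈ A, f a ∈ I) : A.ncard = ∑ i ∈ I, {a | a ∈ A ∧ f a = i}.ncard := by
  classical
  obtain ⟨A, rfl⟩ := hA.exists_finset_coe
  rw [Set.ncard_coe_finset, Finset.card_eq_sum_card_fiberwise (t := I) hf]
  refine Finset.sum_congr rfl fun i _ => ?_
  rw [← Set.ncard_coe_finset]
  congr 1
  ext a
  simp

/-- The primitive binary sequences of length `p` with curling number less than `k`. -/
def primitiveLT (p k : ℕ) : Set (List Bool) := {Y | Y.length = p ∧ Primitive Y ∧ CN Y < k}

theorem primitiveLT_subset (p k : ℕ) : primitiveLT p k ⊆ {S | S.length = p} := fun _ h => h.1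

theorem ncard_primitiveLT (p k : ℕ) : (primitiveLT p k).ncard = qCount p (k - 1) := by
  rw [ncard_eq_sum_fiber ((finite_length_eq p).subset (primitiveLT_subset p k)) CN
    (Finset.Icc 1 (k - 1)), qCount]
  · refine Finset.sum_congr rfl fun i hi => ?_
    rw [pCount]
    congr 1
    ext Y
    rw [Finset.mem_Icc] at hi
    constructor
    · rintro ⟨⟨h1, h2, -⟩, h3⟩
      exact ⟨h1, h3, h2⟩
    · rintro ⟨h1, h2, h3⟩
      exact ⟨⟨h1, h3, by omega⟩, h2⟩
  · rintro Y ⟨-, hY, hC⟩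
    have := one_le_CN hY.1
    rw [Finset.mem_Icc]
    omega

variable {n k p : ℕ}

theorem cCount3_eq_ncard (hk : 2 ≤ k) (hn : n < (k + 1) ^ 2) (hp : k * p ≤ n) :
    cCount3 n k p = {P : List Bool × List Bool |
      P.1.length = n - k * p ∧ P.2 ∈ primitiveLT p k ∧ ¬ P.2 <:+ P.1}.ncard := by
  rw [cCount3]
  symm
  refine Set.ncard_congr (fun P _ => P.1 ++ listPow P.2 k) ?_ ?_ ?_
  · rintro ⟨X, Y⟩ ⟨hX, ⟨hY, hP, hC⟩, hs⟩
    dsimp only at *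
    have hl : (X ++ listPow Y k).length = n := by
      rw [List.length_append, length_listPow, hX, hY]
      omega
    have := CN_piLen_append_listPow hk (by rwa [hl]) hP hC hs
    exact ⟨hl, this.1, by rw [this.2, hY]⟩
  · rintro ⟨X, Y⟩ ⟨X', Y'⟩ ⟨hX, ⟨hY, -⟩, -⟩ ⟨hX', ⟨hY', -⟩, -⟩ h
    dsimp only at *
    obtain ⟨h1, h2⟩ := List.append_inj h (by rw [hX, hX'])
    obtain ⟨k, rfl⟩ := Nat.exists_eq_add_of_le' (show 1 ≤ k by omega)
    rw [listPow, listPow] at h2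
    rw [h1, (List.append_inj h2 (by rw [hY, hY'])).1]
  · rintro S ⟨hS, rfl, rfl⟩
    obtain ⟨X, Y, h, hY, hP, hC, hs⟩ := exists_eq_append_listPow hk
    refine ⟨(X, Y), ⟨?_, ⟨hY, hP, hC⟩, hs⟩, h.symm⟩
    have := congrArg List.length h
    rw [List.length_append, length_listPow, hY] at this
    dsimp only
    omega

theorem cCount3_of_short (hk : 2 ≤ k) (hn : n < (k + 1) ^ 2) (hp : k * p ≤ n)
    (hp' : n < (k + 1) * p) : cCount3 n k p = 2 ^ (n - k * p) * qCount p (k - 1) := by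
  rw [cCount3_eq_ncard hk hn hp, ← ncard_primitiveLT, ← ncard_length_eq, ← Set.ncard_prod]
  congr 1
  ext ⟨X, Y⟩
  constructor
  · rintro ⟨hX, hY, -⟩
    exact ⟨hX, hY⟩
  · rintro ⟨hX, hY⟩
    refine ⟨hX, hY, fun h => ?_⟩
    have h1 := h.length_le
    have h2 : X.length = n - k * p := hX
    have h3 : Y.length = p := hY.1
    rw [add_mul] at hp'
    dsimp only at h1
    omega

theorem ncard_ne_primitiveLT (p k : ℕ) :
    {P : List Bool × List Bool | P.1.length = p ∧ P.2 ∈ primitiveLT p k ∧ P.1 ≠ P.2}.ncard =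
      (2 ^ p - 1) * qCount p (k - 1) := by
  have hfin := (finite_length_eq p).subset (primitiveLT_subset p k)
  have hd : {P : List Bool × List Bool | P.1.length = p ∧ P.2 ∈ primitiveLT p k ∧ P.1 ≠ P.2} =
      ({S | S.length = p} ×ˢ primitiveLT p k) \ ((fun Y => (Y, Y)) '' primitiveLT p k) := by
    ext ⟨V, Y⟩
    constructor
    · rintro ⟨h1, h2, h3⟩
      refine ⟨⟨h1, h2⟩, ?_⟩
      rintro ⟨Z, -, h⟩
      exact h3 ((congrArg Prod.fst h).symm.trans (congrArg Prod.snd h))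
    · rintro ⟨⟨h1, h2⟩, h3⟩
      refine ⟨h1, h2, fun h => h3 ⟨Y, h2, ?_⟩⟩
      dsimp only at h
      rw [h]
  rw [hd, Set.ncard_sdiff _ (hfin.image _), Set.ncard_prod, ncard_length_eq,
    Set.ncard_image_of_injective _ fun a b h => congrArg Prod.fst h, ncard_primitiveLT,
    Nat.sub_mul, one_mul]
  rintro _ ⟨Y, hY, rfl⟩
  exact ⟨hY.1, hY⟩

theorem cCount3_of_long (hk : 2 ≤ k) (hn : n < (k + 1) ^ 2) (hp : (k + 1) * p ≤ n) :
    cCount3 n k p = 2 ^ (n - (k + 1) * p) * (2 ^ p - 1) * qCount p (k - 1) := by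
  have e : (k + 1) * p = k * p + p := by ring
  rw [cCount3_eq_ncard hk hn (by omega), mul_assoc, ← ncard_ne_primitiveLT, ← ncard_length_eq,
    ← Set.ncard_prod]
  symm
  refine Set.ncard_congr (fun P _ => (P.1 ++ P.2.1, P.2.2)) ?_ ?_ ?_
  · rintro ⟨Z, V, Y⟩ ⟨hZ, hV, hY, hne⟩
    dsimp only at *
    have hZ : Z.length = n - (k + 1) * p := hZ
    refine ⟨?_, hY, ?_⟩
    · rw [List.length_append, hZ, hV]
      omega
    · rintro ⟨Z', h⟩
      exact hne (List.append_inj' h (hY.1.trans hV.symm)).2.symm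
  · rintro ⟨Z, V, Y⟩ ⟨Z', V', Y'⟩ ⟨hZ, hV, -⟩ ⟨hZ', hV', -⟩ h
    dsimp only at *
    rw [Prod.mk.injEq] at h
    obtain ⟨h1, h2⟩ := List.append_inj' h.1 (hV.trans hV'.symm)
    rw [h1, h2, h.2]
  · rintro ⟨X, Y⟩ ⟨hX, hY, hs⟩
    dsimp only at *
    refine ⟨(X.take (n - (k + 1) * p), X.drop (n - (k + 1) * p), Y), ⟨?_, ?_, hY, ?_⟩, ?_⟩
    · change (X.take _).length = _
      rw [List.length_take]
      omega
    · change (X.drop _).length = _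
      rw [List.length_drop]
      omega
    · intro h
      dsimp only at h
      rw [← h] at hs
      exact hs (List.drop_suffix _ X)
    · simp only [List.take_append_drop]

theorem cCount_eq_sum (hk : 1 ≤ k) :
    cCount n k = ∑ p ∈ Finset.Icc 1 (n / k), cCount3 n k p := by
  rw [cCount, ncard_eq_sum_fiber ((finite_length_eq n).subset fun _ h => h.1) piLen
    (Finset.Icc 1 (n / k))]
  · refine Finset.sum_congr rfl fun p _ => ?_
    rw [cCount3]
    congr 1
    ext S
    exact and_assoc
  · rintro S ⟨rfl, rfl⟩
    have h := endsWithPow_piLen hk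
    rw [Finset.mem_Icc, Nat.le_div_iff_mul_le (by omega), mul_comm]
    exact ⟨h.1, h.2.1⟩

theorem CN_replicate (n : ℕ) (b : Bool) : CN (List.replicate n b) = n := by
  rcases Nat.eq_zero_or_pos n with rfl | hn
  · exact Nat.le_zero.1 (CN_le_length _)
  · refine le_antisymm ((CN_le_length _).trans (by simp))
      ((le_CN_iff hn).2 ⟨1, le_rfl, by simp, ?_⟩)
    intro i hi
    rw [List.reverse_replicate, List.getElem?_replicate_of_lt (by omega),
      List.getElem?_replicate_of_lt (by omega)]

theorem EndsWithPow.exists_replicate {S : List Bool} (h : EndsWithPow S 1 k) (hk : 1 ≤ k) :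
    ∃ X b, S = X ++ List.replicate k b := by
  obtain ⟨X, Y, -, hY, rfl⟩ := (endsWithPow_iff hk).1 h
  obtain ⟨b, rfl⟩ := List.length_eq_one_iff.1 hY
  exact ⟨X, b, by simp [listPow_eq_flatten]⟩

theorem CN_eq_length_iff {S : List Bool} (hn : 1 ≤ n) (hS : S.length = n) :
    CN S = n ↔ ∃ b, S = List.replicate n b := by
  constructor
  · intro h
    obtain ⟨w, hw⟩ := (le_CN_iff hn).1 h.ge
    have h1 := hw.1
    have h2 := hw.2.1
    have : w = 1 := by
      by_contra hne
      nlinarith [Nat.mul_le_mul_left n (show 2 ≤ w by omega)]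
    rw [this] at hw
    obtain ⟨X, b, h⟩ := hw.exists_replicate hn
    have hl := congrArg List.length h
    rw [List.length_append, List.length_replicate, hS] at hl
    have : X = [] := List.length_eq_zero_iff.1 (by omega)
    exact ⟨b, by rw [h, this, List.nil_append]⟩
  · rintro ⟨b, rfl⟩
    exact CN_replicate n b

theorem ncard_range_bool {α : Type*} (f : Bool → α) (hf : f.Injective) :
    (Set.range f).ncard = 2 := by
  rw [← Set.image_univ, Set.ncard_image_of_injective _ hf, Set.ncard_univ]
  simp

theorem cCount_self (hn : 1 ≤ n) : cCount n n = 2 := by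
  rw [cCount, ← ncard_range_bool (fun b => List.replicate n b) ?_]
  · congr 1
    ext S
    constructor
    · rintro ⟨hS, h⟩
      obtain ⟨b, rfl⟩ := (CN_eq_length_iff hn hS).1 h
      exact ⟨b, rfl⟩
    · rintro ⟨b, rfl⟩
      exact ⟨by simp, CN_replicate n b⟩
  · intro a b h
    exact List.replicate_right_injective (by omega) h

theorem exists_eq_cons_replicate {S : List Bool} (hn : 1 ≤ n) (hS : S.length = n + 1)
    (h : CN S = n) : ∃ b, S = (!b) :: List.replicate n b := by
  have hE : EndsWithPow S 1 n := by
    obtain ⟨w, hw⟩ := (le_CN_iff hn).1 h.ge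
    rcases Nat.lt_or_ge 1 n with h2 | h2
    · have h1 := hw.1
      have h2 := hw.2.1
      have : w = 1 := by
        by_contra hne
        nlinarith [Nat.mul_le_mul_left n (show 2 ≤ w by omega)]
      rwa [this] at hw
    · exact ⟨le_rfl, by omega, fun i hi => by omega⟩
  obtain ⟨X, b, hX⟩ := hE.exists_replicate hn
  have hl := congrArg List.length hX
  rw [List.length_append, List.length_replicate, hS] at hl
  obtain ⟨a, rfl⟩ := List.length_eq_one_iff.1 (show X.length = 1 by omega)
  refine ⟨b, ?_⟩
  have hab : a ≠ b := by
    rintro rfl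
    rw [List.singleton_append, ← List.replicate_succ] at hX
    rw [hX, CN_replicate] at h
    omega
  rw [hX, Bool.eq_not.2 hab]
  rfl

theorem CN_cons_replicate (hn : 1 ≤ n) (b : Bool) : CN ((!b) :: List.replicate n b) = n := by
  have hl : ((!b) :: List.replicate n b).length = n + 1 := by simp
  apply le_antisymm
  · by_contra hgt
    have hle := CN_le_length ((!b) :: List.replicate n b)
    obtain ⟨a, ha⟩ := (CN_eq_length_iff (n := n + 1) (by omega) hl).1 (by omega)
    rw [List.replicate_succ, List.cons.injEq] at ha
    have := List.replicate_right_injective (by omega) ha.2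
    rw [← this] at ha
    simp at ha
  · obtain ⟨w, hw⟩ := (le_CN_iff hn).1 (CN_replicate n b).ge
    exact (le_CN_iff hn).2 ⟨w, hw.append_left [!b]⟩

theorem cCount_pred (hn : 1 ≤ n) : cCount (n + 1) n = 2 := by
  rw [cCount, ← ncard_range_bool (fun b => (!b) :: List.replicate n b) ?_]
  · congr 1
    ext S
    constructor
    · rintro ⟨hS, h⟩
      obtain ⟨b, rfl⟩ := exists_eq_cons_replicate hn hS h
      exact ⟨b, rfl⟩
    · rintro ⟨b, rfl⟩
      exact ⟨by simp, CN_cons_replicate hn b⟩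
  · intro a b h
    simpa using (List.cons.inj h).1

end Counting

/-- `c(n,n) = 2`, `c(n,n-1) = 2` for `n ≥ 2`, and for `n ≥ 4` and `k ≥ ⌊√n⌋`,
explicit formulas for `c(n,k,π)` hold, and `c(n,k) = Σ_{π=1}^{⌊n/k⌋} c(n,k,π)`. -/
theorem thSQRT :
    (∀ n : ℕ, 1 ≤ n → cCount n n = 2) ∧
    (∀ n : ℕ, 2 ≤ n → cCount n (n - 1) = 2) ∧
    (∀ n k : ℕ, 4 ≤ n → Nat.sqrt n ≤ k →
      (∀ π : ℕ, 1 ≤ π → π ≤ n / (k + 1) →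
        cCount3 n k π = 2 ^ (n - (k + 1) * π) * (2 ^ π - 1) * qCount π (k - 1)) ∧
      (∀ π : ℕ, (n + 1 + k) / (k + 1) ≤ π → π ≤ n / k →
        cCount3 n k π = 2 ^ (n - k * π) * qCount π (k - 1)) ∧
      cCount n k = ∑ π ∈ Finset.Icc 1 (n / k), cCount3 n k π) := by
  refine ⟨fun n hn => cCount_self hn, fun n hn => ?_, fun n k hn hk => ?_⟩
  · obtain ⟨n, rfl⟩ := Nat.exists_eq_add_of_le' (show 1 ≤ n by omega)
    exact cCount_pred (by omega)
  · have hk2 : 2 ≤ k := le_trans (Nat.le_sqrt.2 hn) hk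
    have hn' : n < (k + 1) ^ 2 := by
      rw [sq]
      exact Nat.sqrt_lt.1 (by omega)
    refine ⟨fun p _ hp => ?_, fun p hp hp' => ?_, cCount_eq_sum (by omega)⟩
    · rw [Nat.le_div_iff_mul_le (by omega), mul_comm] at hp
      exact cCount3_of_long hk2 hn' hp
    · rw [Nat.le_div_iff_mul_le (by omega), mul_comm] at hp'
      rw [Nat.div_le_iff_le_mul_add_pred (by omega)] at hp
      exact cCount3_of_short hk2 hn' hp' (by omega)
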